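/- arXiv:2011.11903 — 3 statements merged into one kernel-verified Lean document; each statement's English description precedes it below -/
import Mathlib

section
/- Let F be a field, d ≥ 2 an integer, and 1 ≤ i ≤ d−1. The exterior power ∧^i F^d, with the action of the hyperoctahedral group W_d by signed permutations of coordinates, is an irreducible representation of W_d if and only if the characteristic of F is not 2. -/
/-- The sign-change automorphism of `F^d` negating the `k`-th coordinate. -/
def sgnFlip (F : Type*) [Field F] (d : ℕ) (k : Fin d) :
    (Fin d → F) ≃ₗ[F] (Fin d → F) :=
  LinearEquiv.piCongrRight
    (fun j => if j = k then LinearEquiv.neg F else LinearEquiv.refl F F)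

/-- The hyperoctahedral group `W_d = S_2 ≀ S_d`, realized as the subgroup of
`GL(F^d)` generated by the permutations of the standard basis vectors together with
the sign changes `e_k ↦ −e_k`, i.e. acting by signed permutations of coordinates. -/
def hyperoctahedral (F : Type*) [Field F] (d : ℕ) :
    Subgroup ((Fin d → F) ≃ₗ[F] (Fin d → F)) :=
  Subgroup.closure
    ({e | ∃ g : Equiv.Perm (Fin d), e = LinearEquiv.funCongrLeft F F g} ∪
      {e | ∃ k : Fin d, e = sgnFlip F d k})

open Set.powersetCard in
/-- The standard basis wedge products. -/
noncomputable def wedgeE (F : Type) [Field F] (d i : ℕ) (s : Set.powersetCard (Fin d) i) :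
    ExteriorAlgebra F (Fin d → F) :=
  ExteriorAlgebra.ιMulti_family F i (fun j : Fin d => (Pi.single j 1 : Fin d → F)) s

lemma wedgeE_span (F : Type) [Field F] (d i : ℕ) :
    Submodule.span F (Set.range (wedgeE F d i)) = ⋀[F]^i (Fin d → F) := by
  apply exteriorPower.ιMulti_family_span_fixedDegree_of_span
  have := (Pi.basisFun F (Fin d)).span_eq
  rw [← this]
  congr 2
  ext j
  simp

lemma wedgeE_li (F : Type) [Field F] (d i : ℕ) : LinearIndependent F (wedgeE F d i) := by
  have h := exteriorPower.ιMulti_family_linearIndependent_ofBasis F i (Pi.basisFun F (Fin d))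
  have h2 := h.map' (⋀[F]^i (Fin d → F)).subtype (Submodule.ker_subtype _)
  have h3 : wedgeE F d i = (⋀[F]^i (Fin d → F)).subtype ∘
      exteriorPower.ιMulti_family F i (Pi.basisFun F (Fin d)) := by
    have h4 : (Pi.basisFun F (Fin d) : Fin d → Fin d → F) = fun j => Pi.single j 1 := by
      ext j
      simp
    rw [h4]
    rfl
  rw [h3]
  exact h2

open Function in
lemma wedge_inj (F : Type) [Field F] (d i : ℕ) (α : Fin i ↪ Fin d) :
    ∃ u : ℤˣ, ExteriorAlgebra.ιMulti F i (fun a => (Pi.single (α a) 1 : Fin d → F)) =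
      u • wedgeE F d i (Set.powersetCard.ofFinEmb i (Fin d) α) := by
  set s := Set.powersetCard.ofFinEmb i (Fin d) α with hs
  set β := Set.powersetCard.ofFinEmbEquiv.symm s with hβ
  have hr : ∀ a, ∃ b, β b = α a := by
    intro a
    have : α a ∈ Set.range β := by
      rw [hβ, Set.powersetCard.mem_range_ofFinEmbEquiv_symm_iff_mem, hs]
      rw [Set.powersetCard.mem_ofFinEmb_iff_mem_range]
      exact ⟨a, rfl⟩
    exact this
  choose f hf using hr
  have finj : Injective f := fun a b h => α.injective (by rw [← hf, ← hf, h])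
  let σ : Equiv.Perm (Fin i) := Equiv.ofBijective f (Finite.injective_iff_bijective.mp finj)
  refine ⟨σ.sign, ?_⟩
  rw [wedgeE, ← AlternatingMap.map_perm]
  congr 1
  ext a : 1
  simp only [comp_apply]
  rw [← hf a]
  rfl

lemma map_perm_single (F : Type) [Field F] (d : ℕ) (g : Equiv.Perm (Fin d)) (j : Fin d) :
    LinearEquiv.funCongrLeft F F g (Pi.single j 1 : Fin d → F) = Pi.single (g.symm j) 1 := by
  ext k
  simp [LinearEquiv.funCongrLeft_apply, LinearMap.funLeft_apply, Pi.single_apply,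
    Equiv.eq_symm_apply]

lemma map_flip_single (F : Type) [Field F] (d : ℕ) (k : Fin d) (j : Fin d) :
    sgnFlip F d k (Pi.single j 1 : Fin d → F) =
      (if j = k then (-1 : F) else 1) • Pi.single j 1 := by
  ext l
  have h0 : sgnFlip F d k (Pi.single j 1 : Fin d → F) l =
      (if l = k then LinearEquiv.neg F else LinearEquiv.refl F F)
        ((Pi.single j 1 : Fin d → F) l) := rfl
  rw [h0, Pi.smul_apply]
  by_cases h2 : l = j
  · subst h2
    by_cases h : l = k <;> simp [h]
  · simp [h2]

open Classical in
lemma flip_wedgeE (F : Type) [Field F] (d i : ℕ) (k : Fin d) (s : Set.powersetCard (Fin d) i) :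
    ExteriorAlgebra.map (sgnFlip F d k).toLinearMap (wedgeE F d i s) =
      (if k ∈ s then (-1 : F) else 1) • wedgeE F d i s := by
  rw [wedgeE, ExteriorAlgebra.ιMulti_family, ExteriorAlgebra.map_apply_ιMulti]
  have : ((sgnFlip F d k).toLinearMap ∘ (fun j : Fin d => (Pi.single j 1 : Fin d → F)) ∘
      (Set.powersetCard.ofFinEmbEquiv.symm s)) = fun a =>
      (if Set.powersetCard.ofFinEmbEquiv.symm s a = k then (-1 : F) else 1) •
      ((fun j : Fin d => (Pi.single j 1 : Fin d → F)) ∘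
      (Set.powersetCard.ofFinEmbEquiv.symm s)) a := by
    ext a : 1
    simp only [Function.comp_apply, LinearEquiv.coe_coe]
    exact map_flip_single F d k _
  rw [this, ← AlternatingMap.coe_multilinearMap, MultilinearMap.map_smul_univ]
  congr 1
  split_ifs with h
  · rw [← Set.powersetCard.mem_range_ofFinEmbEquiv_symm_iff_mem] at h
    obtain ⟨a, ha⟩ := h
    rw [Finset.prod_eq_single a]
    · simp [ha]
    · intro b _ hb
      rw [if_neg]
      intro h
      exact hb ((Set.powersetCard.ofFinEmbEquiv.symm s).injective (h.trans ha.symm))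
    · simp
  · rw [← Set.powersetCard.mem_range_ofFinEmbEquiv_symm_iff_mem] at h
    apply Finset.prod_eq_one
    intro a _
    rw [if_neg]
    exact fun h' => h ⟨a, h'⟩

lemma perm_wedge (F : Type) [Field F] (d i : ℕ) (g : Equiv.Perm (Fin d)) (α : Fin i → Fin d) :
    ExteriorAlgebra.map (LinearEquiv.funCongrLeft F F g).toLinearMap
      (ExteriorAlgebra.ιMulti F i (fun a => (Pi.single (α a) 1 : Fin d → F))) =
      ExteriorAlgebra.ιMulti F i (fun a => (Pi.single (g.symm (α a)) 1 : Fin d → F)) := by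
  rw [ExteriorAlgebra.map_apply_ιMulti]
  congr 1
  ext a : 1
  exact map_perm_single F d g (α a)

lemma exists_perm_extend (d i : ℕ) (α β : Fin i ↪ Fin d) :
    ∃ g : Equiv.Perm (Fin d), ∀ a, g (α a) = β a := by
  classical
  let e : {x // x ∈ Set.range α} ≃ {x // x ∈ Set.range β} :=
    (Equiv.ofInjective α α.injective).symm.trans (Equiv.ofInjective β β.injective)
  refine ⟨e.extendSubtype, fun a => ?_⟩
  rw [Equiv.extendSubtype_apply_of_mem e (α a) ⟨a, rfl⟩]
  have h : (⟨α a, ⟨a, rfl⟩⟩ : {x // x ∈ Set.range α}) = Equiv.ofInjective α α.injective a := rfl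
  rw [h]
  simp only [e, Equiv.trans_apply, Equiv.symm_apply_apply]
  rfl

lemma irreducible_of_two_ne_zero (F : Type) [Field F] (d i : ℕ) (h2 : (2 : F) ≠ 0)
    (U : Submodule F (ExteriorAlgebra F (Fin d → F))) (hU : U ≤ ⋀[F]^i (Fin d → F))
    (hinv : ∀ e ∈ hyperoctahedral F d,
        U.map (ExteriorAlgebra.map e.toLinearMap).toLinearMap = U) (hne : U ≠ ⊥) :
    U = ⋀[F]^i (Fin d → F) := by
  classical
  have hinv' : ∀ e ∈ hyperoctahedral F d, ∀ x ∈ U,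
      ExteriorAlgebra.map e.toLinearMap x ∈ U := by
    intro e he x hx
    rw [← hinv e he]
    exact ⟨x, hx, rfl⟩
  obtain ⟨x, hx, hx0⟩ := U.exists_mem_ne_zero_of_ne_bot hne
  have hxs := hU hx
  rw [← wedgeE_span, Submodule.mem_span_range_iff_exists_fun] at hxs
  obtain ⟨c, rfl⟩ := hxs
  obtain ⟨s, -, hs⟩ := Finset.exists_ne_zero_of_sum_ne_zero hx0
  have hcs : c s ≠ 0 := fun h => hs (by simp [h])
  have key : ∀ K : Finset (Fin d), ∃ y : Set.powersetCard (Fin d) i → F,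
      (∑ t, y t • wedgeE F d i t) ∈ U ∧ y s ≠ 0 ∧
      ∀ t, (∃ k ∈ K, ¬ (k ∈ s ↔ k ∈ t)) → y t = 0 := by
    intro K
    induction K using Finset.induction_on with
    | empty => exact ⟨c, hx, hcs, by simp⟩
    | insert k K _ ih =>
      obtain ⟨y, hy, hys, hyt⟩ := ih
      refine ⟨fun t => y t + (if k ∈ s then (-1 : F) else 1) *
        ((if k ∈ t then (-1 : F) else 1) * y t), ?_, ?_, ?_⟩
      · have h := hinv' (sgnFlip F d k) (Subgroup.subset_closure (Or.inr ⟨k, rfl⟩)) _ hy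
        have h' := U.add_mem hy (U.smul_mem (if k ∈ s then (-1 : F) else 1) h)
        convert h' using 1
        rw [map_sum, Finset.smul_sum, ← Finset.sum_add_distrib]
        refine Finset.sum_congr rfl fun t _ => ?_
        rw [map_smul, flip_wedgeE, smul_smul, smul_smul, add_smul]
        congr 2
        ring
      · have : y s + y s ≠ 0 := by
          rw [← two_mul]; exact mul_ne_zero h2 hys
        by_cases hk : k ∈ s <;> simpa [hk] using this
      · rintro t ⟨l, hl, hlt⟩
        rcases Finset.mem_insert.mp hl with rfl | hl
        · by_cases h1 : l ∈ s <;> by_cases h3 : l ∈ t <;> simp_all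
        · simp [hyt t ⟨l, hl, hlt⟩]
  obtain ⟨y, hy, hys, hyt⟩ := key Finset.univ
  have hsum : (∑ t, y t • wedgeE F d i t) = y s • wedgeE F d i s := by
    apply Finset.sum_eq_single
    · intro t _ hts
      rw [hyt t, zero_smul]
      by_contra! hcon
      apply hts
      ext k
      exact (hcon k (Finset.mem_univ k)).symm
    · simp
  rw [hsum] at hy
  have hE : wedgeE F d i s ∈ U := (U.smul_mem_iff hys).mp hy
  apply le_antisymm hU
  rw [← wedgeE_span, Submodule.span_le]
  rintro _ ⟨t, rfl⟩
  obtain ⟨g, hg⟩ := exists_perm_extend d i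
    (Set.powersetCard.ofFinEmbEquiv.symm s).toEmbedding
    (Set.powersetCard.ofFinEmbEquiv.symm t).toEmbedding
  have h := hinv' (LinearEquiv.funCongrLeft F F g.symm)
    (Subgroup.subset_closure (Or.inl ⟨_, rfl⟩)) _ hE
  have h3 := perm_wedge F d i g.symm (Set.powersetCard.ofFinEmbEquiv.symm s)
  have h4 : wedgeE F d i t = ExteriorAlgebra.ιMulti F i (fun a =>
      (Pi.single (g.symm.symm (Set.powersetCard.ofFinEmbEquiv.symm s a)) 1 : Fin d → F)) := by
    rw [wedgeE, ExteriorAlgebra.ιMulti_family]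
    congr 1
    ext a : 1
    exact congrArg (fun j => (Pi.single j 1 : Fin d → F)) (hg a).symm
  rw [h4, ← h3]
  exact h

lemma perm_sum (F : Type) [Field F] (d i : ℕ) [CharP F 2] (g : Equiv.Perm (Fin d)) :
    ExteriorAlgebra.map (LinearEquiv.funCongrLeft F F g).toLinearMap
      (∑ s, wedgeE F d i s) = ∑ s, wedgeE F d i s := by
  rw [map_sum]
  apply Fintype.sum_bijective (Set.powersetCard.map i g.symm.toEmbedding)
  · apply Finite.injective_iff_bijective.mp
    intro s t h
    have := congrArg Subtype.val h
    rw [Set.powersetCard.val_map, Set.powersetCard.val_map] at this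
    exact Subtype.ext (Finset.map_injective _ this)
  · intro s
    have h := perm_wedge F d i g (Set.powersetCard.ofFinEmbEquiv.symm s)
    let α : Fin i ↪ Fin d :=
      (Set.powersetCard.ofFinEmbEquiv.symm s).toEmbedding.trans g.symm.toEmbedding
    obtain ⟨u, hu⟩ := wedge_inj F d i α
    have hα : Set.powersetCard.ofFinEmb i (Fin d) α =
        Set.powersetCard.map i g.symm.toEmbedding s := by
      ext k
      rw [Set.powersetCard.mem_coe_iff, Set.powersetCard.mem_coe_iff,
        Set.powersetCard.mem_ofFinEmb_iff_mem_range, Set.powersetCard.mem_map_iff_mem_range]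
      constructor
      · rintro ⟨a, rfl⟩
        exact ⟨_, (Set.powersetCard.mem_range_ofFinEmbEquiv_symm_iff_mem _ _).mp ⟨a, rfl⟩, rfl⟩
      · rintro ⟨b, hb, rfl⟩
        obtain ⟨a, rfl⟩ := (Set.powersetCard.mem_range_ofFinEmbEquiv_symm_iff_mem _ _).mpr hb
        exact ⟨a, rfl⟩
    have hone : ∀ x : ExteriorAlgebra F (Fin d → F), u • x = x := by
      intro x
      rcases Int.units_eq_one_or u with rfl | rfl
      · simp
      · have : (-1 : F) = 1 := CharTwo.neg_eq 1
        rw [Units.neg_smul, one_smul, ← neg_one_smul F, this, one_smul]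
    rw [hone, hα] at hu
    rw [← hu]
    exact h

/-- Let `F` be a field, `d ≥ 2` an integer, and `1 ≤ i ≤ d−1`.  The exterior power
`⋀^i F^d`, with the action of the hyperoctahedral group `W_d` by signed permutations
of coordinates, is an irreducible representation of `W_d` if and only if the
characteristic of `F` is not `2`.  (`⋀^i F^d` is regarded as a submodule of the
exterior algebra of `F^d`, and a subspace `U` of it is `W_d`-invariant when it is
preserved by each of the functorially induced automorphisms of the exterior algebra;
irreducibility says the only such `U` are `0` and `⋀^i F^d`.) -/
theorem exteriorPower_hyperoctahedral_irreducible_iff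
    (F : Type) [Field F] (d i : ℕ) (hd : 2 ≤ d) (hi1 : 1 ≤ i) (hi2 : i ≤ d - 1) :
    (∀ U : Submodule F (ExteriorAlgebra F (Fin d → F)), U ≤ ⋀[F]^i (Fin d → F) →
      (∀ e ∈ hyperoctahedral F d,
        U.map (ExteriorAlgebra.map e.toLinearMap).toLinearMap = U) →
      U = ⊥ ∨ U = ⋀[F]^i (Fin d → F)) ↔ ringChar F ≠ 2 := by
  classical
  constructor
  · intro H hchar
    have : CharP F 2 := by rw [← hchar]; exact ringChar.charP F
    set v := ∑ s, wedgeE F d i s with hv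
    have hfix : ∀ e ∈ hyperoctahedral F d, ExteriorAlgebra.map e.toLinearMap v = v := by
      intro e he
      induction he using Subgroup.closure_induction with
      | mem e he =>
        rcases he with ⟨g, rfl⟩ | ⟨k, rfl⟩
        · exact perm_sum F d i g
        · rw [hv, map_sum]
          refine Finset.sum_congr rfl fun s _ => ?_
          rw [flip_wedgeE, CharTwo.neg_eq, ite_self, one_smul]
      | one =>
        have : ((1 : (Fin d → F) ≃ₗ[F] (Fin d → F))).toLinearMap = LinearMap.id := rfl
        rw [this, ExteriorAlgebra.map_id]
        rfl
      | mul a b _ _ ha hb =>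
        have : (a * b).toLinearMap = a.toLinearMap ∘ₗ b.toLinearMap := rfl
        rw [this, ← ExteriorAlgebra.map_comp_map, AlgHom.comp_apply, hb, ha]
      | inv a _ ha =>
        have : (a⁻¹).toLinearMap ∘ₗ a.toLinearMap = LinearMap.id := by
          refine LinearMap.ext fun x => ?_
          exact a.symm_apply_apply x
        conv_lhs => rw [← ha]
        rw [← AlgHom.comp_apply, ExteriorAlgebra.map_comp_map, this, ExteriorAlgebra.map_id]
        rfl
    have hnt : Nontrivial (Set.powersetCard (Fin d) i) :=
      Set.powersetCard.nontrivial' (by omega) (by simp; omega)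
    obtain ⟨s, t, hst⟩ := hnt
    have li := Fintype.linearIndependent_iff.mp (wedgeE_li F d i)
    have hle : Submodule.span F {v} ≤ ⋀[F]^i (Fin d → F) := by
      rw [Submodule.span_le, Set.singleton_subset_iff, SetLike.mem_coe, ← wedgeE_span]
      exact Submodule.sum_mem _ fun s _ => Submodule.subset_span ⟨s, rfl⟩
    have hst' : ∀ e ∈ hyperoctahedral F d, (Submodule.span F {v}).map
        (ExteriorAlgebra.map e.toLinearMap).toLinearMap = Submodule.span F {v} := by
      intro e he
      rw [Submodule.map_span, Set.image_singleton]
      exact congrArg (fun w => Submodule.span F {w}) (hfix e he)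
    rcases H (Submodule.span F {v}) hle hst' with h | h
    · rw [Submodule.span_singleton_eq_bot] at h
      have := li (fun _ => 1) (by simpa [hv] using h) s
      exact one_ne_zero this
    · have hs : wedgeE F d i s ∈ Submodule.span F {v} := by
        rw [h, ← wedgeE_span]
        exact Submodule.subset_span ⟨s, rfl⟩
      obtain ⟨a, ha⟩ := Submodule.mem_span_singleton.mp hs
      have := li (fun r => a - if r = s then 1 else 0) (by
        simp only [sub_smul, Finset.sum_sub_distrib, ← Finset.smul_sum, ite_smul, one_smul,
          zero_smul, Finset.sum_ite_eq', Finset.mem_univ, if_true]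
        rw [← hv, ha, sub_self])
      have h1 := this s
      have h2 := this t
      simp [hst.symm] at h1 h2
      rw [h2] at h1
      simp at h1
  · intro hchar U hU hinv
    by_cases hne : U = ⊥
    · exact Or.inl hne
    · exact Or.inr (irreducible_of_two_ne_zero F d i (Ring.two_ne_zero hchar) U hU hinv hne)
end

section
/- Fix an integer d ≥ 2. There exist constants C₀ > 0 and C₁ > 0, depending only on d, such that for every N ≥ 1 and every p ∈ [0,1], bond percolation on the torus T^d_N satisfies ℙ_p(S^□) ≥ C₀ · ℙ_p(A^□)^{C₁}. -/
/-!
Bond percolation on the torus `T^d_N`.  A configuration assigns `true`/`false`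
(open/closed) to each edge of the graph on `(ℤ/Nℤ)^d` in which a vertex is joined
to its translates by standard basis vectors; edges are indexed by a vertex together
with a direction.  A configuration lifts `N`-periodically to `ℤ^d`, and the
giant-cycle event `A^□` asks for two distinct points of `ℤ^d`, congruent mod `N`,
joined by a path of open edges of the periodic lift.
-/

namespace TorusPerc

/-- The standard basis vector `e i` of `ℤ^d`. -/
def stdVec (d : ℕ) (i : Fin d) : Fin d → ℤ := fun j => if j = i then 1 else 0

/-- An edge of the cubical torus: a vertex of `(ℤ/Nℤ)^d` together with a direction. -/
abbrev Edge (d N : ℕ) := (Fin d → ZMod N) × Fin d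

/-- A bond configuration on the torus. -/
abbrev Config (d N : ℕ) := Edge d N → Bool

/-- Reduction of a point of `ℤ^d` modulo `N`. -/
def proj (d N : ℕ) (x : Fin d → ℤ) : Fin d → ZMod N := fun i => (x i : ZMod N)

/-- The edge of the periodic lift going from `x` in direction `i` is open. -/
def liftOpen (d N : ℕ) (ω : Config d N) (x : Fin d → ℤ) (i : Fin d) : Prop :=
  ω (proj d N x, i) = true

/-- One step along an open edge of the periodic lift. -/
def step (d N : ℕ) (ω : Config d N) (x y : Fin d → ℤ) : Prop :=
  (∃ i, y = x + stdVec d i ∧ liftOpen d N ω x i) ∨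
  (∃ i, x = y + stdVec d i ∧ liftOpen d N ω y i)

/-- Connectivity by paths of open edges in the periodic lift. -/
def connected (d N : ℕ) (ω : Config d N) : (Fin d → ℤ) → (Fin d → ℤ) → Prop :=
  Relation.ReflTransGen (step d N ω)

/-- The giant-cycle event `A^□`: some two distinct points of `ℤ^d` which are congruent
modulo `N` are joined by an open path of the periodic lift. -/
def giantEvent (d N : ℕ) : Set (Config d N) :=
  {ω | ∃ x y : Fin d → ℤ, x ≠ y ∧ proj d N x = proj d N y ∧ connected d N ω x y}

/-- The set of winding vectors realized by a configuration. -/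
def winding (d N : ℕ) (ω : Config d N) : Set (Fin d → ℤ) :=
  {w | ∃ x : Fin d → ℤ, connected d N ω x (x + (N : ℤ) • w)}

/-- The realized winding vectors, regarded as vectors in `ℚ^d`. -/
def windingQ (d N : ℕ) (ω : Config d N) : Set (Fin d → ℚ) :=
  (fun w : Fin d → ℤ => fun i => (w i : ℚ)) '' winding d N ω

/-- The spanning event `S^□`: the realized winding vectors span `ℚ^d`. -/
def spanEvent (d N : ℕ) : Set (Config d N) :=
  {ω | Submodule.span ℚ (windingQ d N ω) = ⊤}

/-- The probability of an event under Bernoulli(`p`) bond percolation on the torus: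
each edge is open independently with probability `p`. -/
noncomputable def prob (d N : ℕ) (p : ℝ) (S : Set (Config d N)) : ℝ :=
  ∑ᶠ ω ∈ S, ∏ᶠ e : Edge d N, (if ω e then p else 1 - p)

end TorusPerc

namespace TorusPerc

open Finset

/-- The Bernoulli weight of a configuration. -/
noncomputable def wt (d N : ℕ) [NeZero N] (p : ℝ) (ω : Config d N) : ℝ :=
  ∏ e : Edge d N, (if ω e then p else 1 - p)

/-- Indicator of an event. -/
noncomputable def ind {α : Type*} (S : Set α) (ω : α) : ℝ := S.indicator (fun _ => (1 : ℝ)) ω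

lemma prob_eq (d N : ℕ) [NeZero N] (p : ℝ) (S : Set (Config d N)) :
    prob d N p S = ∑ ω, wt d N p ω * ind S ω := by
  classical
  unfold prob
  rw [finsum_mem_eq_finite_toFinset_sum _ (Set.toFinite S)]
  rw [← Finset.sum_subset (Finset.subset_univ (Set.toFinite S).toFinset)]
  · refine Finset.sum_congr rfl fun ω hω => ?_
    have h : ω ∈ S := by simpa using hω
    rw [finprod_eq_prod_of_fintype]
    simp [ind, h, wt]
  · intro ω _ hω
    have h : ω ∉ S := by simpa using hω
    simp [ind, h]

lemma wt_nonneg (d N : ℕ) [NeZero N] {p : ℝ} (hp : p ∈ Set.Icc (0 : ℝ) 1) (ω : Config d N) :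
    0 ≤ wt d N p ω := by
  refine Finset.prod_nonneg fun e _ => ?_
  split_ifs
  · exact hp.1
  · linarith [hp.2]

lemma wt_sum (d N : ℕ) [NeZero N] (p : ℝ) : ∑ ω, wt d N p ω = 1 := by
  classical
  have h := Finset.prod_univ_sum (fun _ : Edge d N => (Finset.univ : Finset Bool))
    (fun _ b => if b then p else 1 - p)
  rw [Fintype.piFinset_univ] at h
  unfold wt
  rw [← h]
  simp

lemma wt_lattice (d N : ℕ) [NeZero N] (p : ℝ) (a b : Config d N) :
    wt d N p a * wt d N p b ≤ wt d N p (a ⊓ b) * wt d N p (a ⊔ b) := by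
  apply le_of_eq
  unfold wt
  rw [← Finset.prod_mul_distrib, ← Finset.prod_mul_distrib]
  refine Finset.prod_congr rfl fun e _ => ?_
  rw [Pi.inf_apply, Pi.sup_apply]
  cases a e <;> cases b e <;> simp [mul_comm]

lemma ind_nonneg {α : Type*} (S : Set α) (ω : α) : 0 ≤ ind S ω :=
  Set.indicator_nonneg (fun _ _ => zero_le_one) ω

lemma ind_mono {d N : ℕ} {S : Set (Config d N)} (h : IsUpperSet S) : Monotone (ind S) := by
  intro a b hab
  unfold ind
  by_cases ha : a ∈ S
  · simp [ha, h hab ha]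
  · simp only [ha, not_false_eq_true, Set.indicator_of_notMem]
    exact ind_nonneg S b

lemma prob_nonneg (d N : ℕ) [NeZero N] {p : ℝ} (hp : p ∈ Set.Icc (0 : ℝ) 1)
    (S : Set (Config d N)) : 0 ≤ prob d N p S := by
  rw [prob_eq]
  exact Finset.sum_nonneg fun ω _ => mul_nonneg (wt_nonneg d N hp ω) (ind_nonneg S ω)

lemma prob_mono (d N : ℕ) [NeZero N] {p : ℝ} (hp : p ∈ Set.Icc (0 : ℝ) 1)
    {S T : Set (Config d N)} (h : S ⊆ T) : prob d N p S ≤ prob d N p T := by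
  rw [prob_eq, prob_eq]
  refine Finset.sum_le_sum fun ω _ => mul_le_mul_of_nonneg_left ?_ (wt_nonneg d N hp ω)
  exact Set.indicator_le_indicator_of_subset h (fun _ => zero_le_one) ω

lemma prob_univ (d N : ℕ) [NeZero N] (p : ℝ) : prob d N p Set.univ = 1 := by
  rw [prob_eq]; simp [ind, wt_sum]

lemma harris (d N : ℕ) [NeZero N] {p : ℝ} (hp : p ∈ Set.Icc (0 : ℝ) 1)
    {S T : Set (Config d N)} (hS : IsUpperSet S) (hT : IsUpperSet T) :
    prob d N p S * prob d N p T ≤ prob d N p (S ∩ T) := by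
  classical
  have h := fkg (μ := wt d N p) (f := ind S) (g := ind T) (fun ω => wt_nonneg d N hp ω)
    (fun ω => ind_nonneg S ω) (fun ω => ind_nonneg T ω) (ind_mono hS) (ind_mono hT)
    (wt_lattice d N p)
  rw [wt_sum, one_mul] at h
  rw [prob_eq, prob_eq, prob_eq]
  refine h.trans (le_of_eq (Finset.sum_congr rfl fun ω _ => ?_))
  congr 1
  by_cases h1 : ω ∈ S <;> by_cases h2 : ω ∈ T <;> simp [ind, h1, h2]

lemma harris_finset (d N : ℕ) [NeZero N] {p : ℝ} (hp : p ∈ Set.Icc (0 : ℝ) 1)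
    {ι : Type*} (E : ι → Set (Config d N)) (hE : ∀ k, IsUpperSet (E k)) (s : Finset ι) :
    ∏ k ∈ s, prob d N p (E k) ≤ prob d N p (⋂ k ∈ s, E k) := by
  classical
  induction s using Finset.induction_on with
  | empty => simp [prob_univ]
  | insert a s ha ih =>
    rw [Finset.prod_insert ha, Finset.set_biInter_insert]
    refine (mul_le_mul_of_nonneg_left ih (prob_nonneg d N hp _)).trans ?_
    exact harris d N hp (hE a) (isUpperSet_iInter₂ fun k _ => hE k)

lemma prob_union (d N : ℕ) [NeZero N] {p : ℝ} (hp : p ∈ Set.Icc (0 : ℝ) 1)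
    {ι : Type*} [Fintype ι] (E : ι → Set (Config d N)) (A : Set (Config d N))
    (hA : A ⊆ ⋃ k, E k) : prob d N p A ≤ ∑ k, prob d N p (E k) := by
  simp_rw [prob_eq]
  rw [Finset.sum_comm]
  refine Finset.sum_le_sum fun ω _ => ?_
  rw [← Finset.mul_sum]
  refine mul_le_mul_of_nonneg_left ?_ (wt_nonneg d N hp ω)
  by_cases h : ω ∈ A
  · obtain ⟨k, hk⟩ := Set.mem_iUnion.1 (hA h)
    refine le_trans (le_of_eq ?_)
      (Finset.single_le_sum (fun k _ => ind_nonneg (E k) ω) (Finset.mem_univ k))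
    simp [ind, h, hk]
  · have : ind A ω = 0 := by simp [ind, h]
    rw [this]
    exact Finset.sum_nonneg fun k _ => ind_nonneg (E k) ω

lemma prob_comp (d N : ℕ) [NeZero N] (p : ℝ) (τ : Edge d N ≃ Edge d N)
    (S : Set (Config d N)) :
    prob d N p {ω | ω ∘ τ ∈ S} = prob d N p S := by
  rw [prob_eq, prob_eq]
  refine Fintype.sum_equiv (Equiv.arrowCongr τ.symm (Equiv.refl Bool)) _ _ fun ω => ?_
  have h : (Equiv.arrowCongr τ.symm (Equiv.refl Bool)) ω = ω ∘ τ := by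
    ext e; simp [Equiv.arrowCongr]
  rw [h]
  congr 1
  unfold wt
  exact (Equiv.prod_comp τ (fun e => if ω e then p else 1 - p)).symm

/-- The signed permutation of coordinates. -/
def phi {d : ℕ} (t : Fin d → ℤˣ) (σ : Equiv.Perm (Fin d)) (x : Fin d → ℤ) : Fin d → ℤ :=
  fun j => (t j : ℤ) * x (σ j)

/-- The action of a signed permutation on the edges. -/
def tau {d N : ℕ} (t : Fin d → ℤˣ) (σ : Equiv.Perm (Fin d)) (e : Edge d N) : Edge d N :=
  (fun j => ((t j : ℤ) : ZMod N) * e.1 (σ j) - if σ j = e.2 ∧ t j = -1 then 1 else 0, σ.symm e.2)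

lemma tau_injective {d N : ℕ} (t : Fin d → ℤˣ) (σ : Equiv.Perm (Fin d)) :
    Function.Injective (tau (N := N) t σ) := by
  rintro ⟨v, i⟩ ⟨v', i'⟩ h
  have h2 : i = i' := by simpa [tau] using congrArg Prod.snd h
  subst h2
  have h1 := congrArg Prod.fst h
  simp only [tau] at h1
  congr 1
  ext j
  have h3 := congrFun h1 (σ.symm j)
  simp only [Equiv.apply_symm_apply, sub_left_inj] at h3
  rcases Int.units_eq_one_or (t (σ.symm j)) with h4 | h4 <;> simpa [h4] using h3

lemma step_symm {d N : ℕ} {ω : Config d N} {x y : Fin d → ℤ} (h : step d N ω x y) :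
    step d N ω y x := Or.symm h

lemma step_phi {d N : ℕ} (t : Fin d → ℤˣ) (σ : Equiv.Perm (Fin d)) {ω : Config d N}
    {x y : Fin d → ℤ} (h : step d N (ω ∘ tau t σ) x y) :
    step d N ω (phi t σ x) (phi t σ y) := by
  have key : ∀ x : Fin d → ℤ, ∀ i, liftOpen d N (ω ∘ tau t σ) x i →
      step d N ω (phi t σ x) (phi t σ (x + stdVec d i)) := by
    intro x i hx
    simp only [liftOpen, Function.comp] at hx
    rcases Int.units_eq_one_or (t (σ.symm i)) with h4 | h4
    · left
      refine ⟨σ.symm i, ?_, ?_⟩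
      · ext j
        by_cases hj : j = σ.symm i
        · subst hj; simp [phi, stdVec, h4]
        · have : σ j ≠ i := fun hh => hj (by rw [← hh]; simp)
          simp [phi, stdVec, hj, this]
      · unfold liftOpen
        convert hx using 2
        simp only [tau, Prod.mk.injEq, and_true]
        ext j
        have : ¬ (σ j = i ∧ t j = -1) := by
          rintro ⟨hh, h5⟩
          have : j = σ.symm i := by rw [← hh]; simp
          rw [← this, h5] at h4
          exact absurd h4 (by decide)
        simp [proj, phi, this]
    · right
      refine ⟨σ.symm i, ?_, ?_⟩
      · ext j
        by_cases hj : j = σ.symm i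
        · subst hj; simp [phi, stdVec, h4]
        · have : σ j ≠ i := fun hh => hj (by rw [← hh]; simp)
          simp [phi, stdVec, hj, this]
      · unfold liftOpen
        convert hx using 2
        simp only [tau, Prod.mk.injEq, and_true]
        ext j
        by_cases hj : j = σ.symm i
        · subst hj; simp [proj, phi, stdVec, h4]; ring
        · have : σ j ≠ i := fun hh => hj (by rw [← hh]; simp)
          simp [proj, phi, stdVec, this]
  rcases h with ⟨i, rfl, h⟩ | ⟨i, rfl, h⟩
  · exact key _ _ h
  · exact step_symm (key _ _ h)

lemma winding_phi {d N : ℕ} (t : Fin d → ℤˣ) (σ : Equiv.Perm (Fin d)) {ω : Config d N}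
    {w : Fin d → ℤ} (h : w ∈ winding d N (ω ∘ tau t σ)) : phi t σ w ∈ winding d N ω := by
  obtain ⟨x, hx⟩ := h
  refine ⟨phi t σ x, ?_⟩
  have h2 : connected d N ω (phi t σ x) (phi t σ (x + (N : ℤ) • w)) := Relation.ReflTransGen.lift (p := step d N ω) (phi t σ)
    (fun a b hab => step_phi t σ hab) _ _ hx
  convert h2 using 1
  ext j
  simp [phi]; ring

/-- Some winding vector lies in the orthant `s` with nonzero coordinate `i`. -/
def orth (d N : ℕ) (k : Fin d × (Fin d → ℤˣ)) : Set (Config d N) :=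
  {ω | ∃ w ∈ winding d N ω, w k.1 ≠ 0 ∧ ∀ j, 0 ≤ (k.2 j : ℤ) * w j}

lemma step_mono {d N : ℕ} {ω ω' : Config d N} (h : ω ≤ ω') {x y : Fin d → ℤ}
    (hs : step d N ω x y) : step d N ω' x y := by
  have key : ∀ x i, liftOpen d N ω x i → liftOpen d N ω' x i := by
    intro x i hx
    have := h (proj d N x, i)
    unfold liftOpen at *
    rw [hx] at this
    exact top_le_iff.1 this
  rcases hs with ⟨i, h1, h2⟩ | ⟨i, h1, h2⟩
  · exact Or.inl ⟨i, h1, key _ _ h2⟩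
  · exact Or.inr ⟨i, h1, key _ _ h2⟩

lemma orth_upper (d N : ℕ) (k : Fin d × (Fin d → ℤˣ)) : IsUpperSet (orth d N k) := by
  rintro ω ω' h ⟨w, ⟨x, hx⟩, h2⟩
  exact ⟨w, ⟨x, Relation.ReflTransGen.mono (fun a b hab => step_mono h hab) _ _ hx⟩, h2⟩

lemma orth_le (d N : ℕ) [NeZero N] {p : ℝ} (hp : p ∈ Set.Icc (0 : ℝ) 1)
    (k k' : Fin d × (Fin d → ℤˣ)) :
    prob d N p (orth d N k) ≤ prob d N p (orth d N k') := by
  classical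
  let σ := Equiv.swap k'.1 k.1
  let t : Fin d → ℤˣ := fun j => k'.2 j * k.2 (σ j)
  let τ : Edge d N ≃ Edge d N :=
    Equiv.ofBijective (tau t σ) (Finite.injective_iff_bijective.1 (tau_injective t σ))
  rw [← prob_comp d N p τ (orth d N k)]
  refine prob_mono d N hp ?_
  rintro ω ⟨w, hw, h1, h2⟩
  refine ⟨phi t σ w, winding_phi t σ hw, ?_, ?_⟩
  · simp only [phi, σ, Equiv.swap_apply_left]
    exact mul_ne_zero (Units.ne_zero _) h1
  · intro j
    have h3 : (k'.2 j : ℤ) * phi t σ w j = (k.2 (σ j) : ℤ) * w (σ j) := by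
      simp only [phi, t, Units.val_mul]
      rcases Int.units_eq_one_or (k'.2 j) with h | h <;> rw [h] <;> simp
    rw [h3]; exact h2 _

lemma giant_subset (d N : ℕ) : giantEvent d N ⊆ ⋃ k, orth d N k := by
  rintro ω ⟨x, y, hne, hp, hc⟩
  have h : ∀ j, ∃ w : ℤ, y j = x j + N * w := by
    intro j
    have h1 : ((x j : ℤ) : ZMod N) = (y j : ZMod N) := congrFun hp j
    obtain ⟨w, hw⟩ := (ZMod.intCast_eq_intCast_iff_dvd_sub _ _ _).1 h1
    exact ⟨w, by linarith⟩
  choose w hw using h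
  have hy : y = x + (N : ℤ) • w := by ext j; simp [hw]
  obtain ⟨i, hi⟩ : ∃ i, w i ≠ 0 := by
    by_contra! hh
    exact hne (by rw [hy]; ext j; simp [hh])
  refine Set.mem_iUnion.2 ⟨(i, fun j => if 0 ≤ w j then 1 else -1), w, ⟨x, hy ▸ hc⟩, hi, ?_⟩
  intro j
  dsimp only
  split_ifs with h
  · simpa using h
  · simp; omega

lemma span_superset (d N : ℕ) : (⋂ k ∈ Finset.univ, orth d N k) ⊆ spanEvent d N := by
  classical
  intro ω hω
  have hω' : ∀ k, ω ∈ orth d N k := by simpa using hω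
  by_contra hne
  have hlt : Submodule.span ℚ (windingQ d N ω) < ⊤ := lt_top_iff_ne_top.2 hne
  obtain ⟨f, hf, hle⟩ := Submodule.exists_le_ker_of_lt_top _ hlt
  have hfx : ∀ v, f v = ∑ j, v j * f (Pi.single j 1) := by
    intro v
    conv_lhs => rw [pi_eq_sum_univ' v]
    rw [map_sum]
    refine Finset.sum_congr rfl fun j _ => ?_
    rw [map_smul, smul_eq_mul]
  obtain ⟨i, hi⟩ : ∃ i, f (Pi.single i 1) ≠ 0 := by
    by_contra! hh
    exact hf (LinearMap.ext fun v => by rw [hfx]; simp [hh])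
  obtain ⟨w, hw, h1, h2⟩ :=
    hω' (i, fun j => if 0 ≤ f (Pi.single j 1) then 1 else -1)
  have h0 : f (fun j => (w j : ℚ)) = 0 :=
    hle (Submodule.subset_span ⟨w, hw, rfl⟩)
  rw [hfx] at h0
  have hnn : ∀ j ∈ Finset.univ, 0 ≤ (w j : ℚ) * f (Pi.single j 1) := by
    intro j _
    have h3 := h2 j
    dsimp only at h3
    split_ifs at h3 with h
    · exact mul_nonneg (by simpa using h3) h
    · refine mul_nonneg_of_nonpos_of_nonpos ?_ (le_of_not_ge h)
      have : w j ≤ 0 := by simpa using h3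
      exact_mod_cast this
  have h4 := (Finset.sum_eq_zero_iff_of_nonneg hnn).1 h0 i (Finset.mem_univ i)
  rcases mul_eq_zero.1 h4 with h5 | h5
  · exact h1 (by exact_mod_cast h5)
  · exact hi h5

end TorusPerc

/-- Fix `d ≥ 2`.  There are constants `C₀ > 0` and `C₁ > 0`, depending only on `d`,
such that for every `N ≥ 1` and every `p ∈ [0,1]`, bond percolation on the torus
`T^d_N` satisfies `ℙ_p(S^□) ≥ C₀ · ℙ_p(A^□)^{C₁}`. -/
theorem torus_span_prob_ge_of_giant_prob (d : ℕ) (hd : 2 ≤ d) :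
    ∃ C₀ C₁ : ℝ, 0 < C₀ ∧ 0 < C₁ ∧
      ∀ N : ℕ, 1 ≤ N → ∀ p : ℝ, p ∈ Set.Icc (0 : ℝ) 1 →
        C₀ * TorusPerc.prob d N p (TorusPerc.giantEvent d N) ^ C₁ ≤
          TorusPerc.prob d N p (TorusPerc.spanEvent d N) := by
  have : Nonempty (Fin d) := ⟨⟨0, by omega⟩⟩
  obtain ⟨K, hK⟩ : ∃ K : ℕ, K = Fintype.card (Fin d × (Fin d → ℤˣ)) := ⟨_, rfl⟩
  have hK0 : (0 : ℝ) < K := by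
    rw [hK]; exact_mod_cast Fintype.card_pos
  refine ⟨((K : ℝ)⁻¹) ^ K, K, by positivity, hK0, ?_⟩
  intro N hN p hp
  have : NeZero N := ⟨by omega⟩
  rw [Real.rpow_natCast, ← mul_pow]
  refine le_trans ?_ (TorusPerc.prob_mono d N hp (TorusPerc.span_superset d N))
  refine le_trans ?_ (TorusPerc.harris_finset d N hp _ (TorusPerc.orth_upper d N) Finset.univ)
  have hA := TorusPerc.prob_nonneg d N hp (TorusPerc.giantEvent d N)
  have hk : ∀ k, (K : ℝ)⁻¹ * TorusPerc.prob d N p (TorusPerc.giantEvent d N) ≤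
      TorusPerc.prob d N p (TorusPerc.orth d N k) := by
    intro k
    rw [inv_mul_le_iff₀ hK0]
    refine (TorusPerc.prob_union d N hp _ _ (TorusPerc.giant_subset d N)).trans ?_
    refine (Finset.sum_le_sum fun k' _ => TorusPerc.orth_le d N hp k' k).trans ?_
    rw [Finset.sum_const, Finset.card_univ, ← hK, nsmul_eq_mul]
  refine le_trans (le_of_eq ?_) (Finset.prod_le_prod
    (fun k _ => mul_nonneg (inv_nonneg.2 hK0.le) hA) (fun k _ => hk k))
  rw [Finset.prod_const, Finset.card_univ, ← hK]
end

section
/- Fix an integer d ≥ 2 and p > p̂_c(d). Then there exists δ > 0 such that for every N ≥ 1, bond percolation on the torus T^d_N satisfies ℙ_p(A^□) ≥ δ. -/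
/-!
Bond percolation on `ℤ^d` and its critical probability `p̂_c(d)`.
The event that the origin lies in an infinite open cluster has probability
`θ(p) = inf_M ℙ_p(0 ↔ ∂[-M,M]^d)`, where the connection event depends only on the
(finitely many) edges with both endpoints in the box `[-M,M]^d`, so that its
probability is a finite Bernoulli sum.  `p̂_c(d)` is the supremum of the `p ∈ [0,1]`
with `θ(p) = 0`.
-/

namespace ZLattice

/-- The edge of `ℤ^d` from `e.1` in direction `e.2` has both endpoints in `[-M,M]^d`. -/
def inBox (d M : ℕ) (e : (Fin d → ℤ) × Fin d) : Prop :=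
  (∀ j, |e.1 j| ≤ (M : ℤ)) ∧ (∀ j, |(e.1 + TorusPerc.stdVec d e.2) j| ≤ (M : ℤ))

/-- A bond configuration on the edges of the box `[-M,M]^d`. -/
abbrev BoxConfig (d M : ℕ) := {e : (Fin d → ℤ) × Fin d // inBox d M e} → Bool

/-- The edge from `x` in direction `i` lies in the box and is open. -/
def edgeOpen (d M : ℕ) (η : BoxConfig d M) (x : Fin d → ℤ) (i : Fin d) : Prop :=
  ∃ h : inBox d M (x, i), η ⟨(x, i), h⟩ = true

/-- One step along an open edge of the box. -/
def step (d M : ℕ) (η : BoxConfig d M) (x y : Fin d → ℤ) : Prop :=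
  (∃ i, y = x + TorusPerc.stdVec d i ∧ edgeOpen d M η x i) ∨
  (∃ i, x = y + TorusPerc.stdVec d i ∧ edgeOpen d M η y i)

/-- Connectivity by open paths inside the box. -/
def connected (d M : ℕ) (η : BoxConfig d M) : (Fin d → ℤ) → (Fin d → ℤ) → Prop :=
  Relation.ReflTransGen (step d M η)

/-- The origin is joined to the boundary of the box `[-M,M]^d` by an open path. -/
def reachBoundary (d M : ℕ) : Set (BoxConfig d M) :=
  {η | ∃ y : Fin d → ℤ, (∃ j, |y j| = (M : ℤ)) ∧ connected d M η 0 y}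

/-- Probability of an event for Bernoulli(`p`) bond percolation on the box. -/
noncomputable def prob (d M : ℕ) (p : ℝ) (S : Set (BoxConfig d M)) : ℝ :=
  ∑ᶠ η ∈ S, ∏ᶠ e : {e : (Fin d → ℤ) × Fin d // inBox d M e}, (if η e then p else 1 - p)

/-- `θ(p)`: the probability that the origin of `ℤ^d` lies in an infinite open cluster. -/
noncomputable def theta (d : ℕ) (p : ℝ) : ℝ := ⨅ M : ℕ, prob d M p (reachBoundary d M)

/-- The critical probability `p̂_c(d)` of Bernoulli bond percolation on `ℤ^d`. -/
noncomputable def hatPc (d : ℕ) : ℝ := sSup {p : ℝ | p ∈ Set.Icc (0 : ℝ) 1 ∧ theta d p = 0}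

end ZLattice

/-! ### Finite Bernoulli probabilities -/

namespace GiantProof

open Classical in
/-- Bernoulli weight of a configuration. -/
noncomputable def wt {G : Type*} [Fintype G] (p : ℝ) (ω : G → Bool) : ℝ :=
  ∏ g, (if ω g then p else 1 - p)

open Classical in
/-- Bernoulli probability of an event on a finite product. -/
noncomputable def P {G : Type*} [Fintype G] (p : ℝ) (S : Set (G → Bool)) : ℝ :=
  ∑ ω, if ω ∈ S then wt p ω else 0

theorem wt_nonneg {G : Type*} [Fintype G] {p : ℝ} (h0 : 0 ≤ p) (h1 : p ≤ 1) (ω : G → Bool) :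
    0 ≤ wt p ω := by
  unfold wt
  refine Finset.prod_nonneg fun g _ => ?_
  split_ifs <;> linarith

theorem P_nonneg {G : Type*} [Fintype G] {p : ℝ} (h0 : 0 ≤ p) (h1 : p ≤ 1)
    (S : Set (G → Bool)) : 0 ≤ P p S := by
  unfold P
  refine Finset.sum_nonneg fun ω _ => ?_
  split_ifs
  · exact wt_nonneg h0 h1 ω
  · exact le_rfl

theorem P_mono {G : Type*} [Fintype G] {p : ℝ} (h0 : 0 ≤ p) (h1 : p ≤ 1)
    {S T : Set (G → Bool)} (h : S ⊆ T) : P p S ≤ P p T := by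
  unfold P
  refine Finset.sum_le_sum fun ω _ => ?_
  by_cases hS : ω ∈ S
  · simp [hS, h hS]
  · by_cases hT : ω ∈ T
    · simp [hS, hT, wt_nonneg h0 h1 ω]
    · simp [hS, hT]

open Classical in
/-- Sum over the configurations with coordinatewise constraints. -/
theorem sum_constraint {G β : Type*} [Fintype G] [Fintype β] (v : G → β → ℝ)
    (R : G → β → Prop) :
    (∑ σ : G → β, if ∀ g, R g (σ g) then ∏ g, v g (σ g) else 0)
      = ∏ g, ∑ b, if R g b then v g b else 0 := by
  rw [Finset.prod_univ_sum]
  rw [Fintype.piFinset_univ]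
  refine Finset.sum_congr rfl fun σ _ => ?_
  split_ifs with h
  · exact Finset.prod_congr rfl fun g _ => by simp [h g]
  · push Not at h
    obtain ⟨g, hg⟩ := h
    exact (Finset.prod_eq_zero (Finset.mem_univ g) (by simp [hg])).symm

open Classical in
/-- Marginals along an injection. -/
theorem marginal_point {F G : Type*} [Fintype F] [Fintype G] (p : ℝ) (ι : F → G)
    (hι : Function.Injective ι) (ζ : F → Bool) :
    (∑ ω : G → Bool, if ω ∘ ι = ζ then wt p ω else 0) = wt p ζ := by
  have h1 : ∀ ω : G → Bool, (ω ∘ ι = ζ) ↔ ∀ g, (∀ f, ι f = g → ω g = ζ f) := by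
    intro ω
    constructor
    · rintro rfl g f rfl
      rfl
    · intro h
      funext f
      exact h _ f rfl
  have := sum_constraint (G := G) (β := Bool) (fun _ b => if b = true then p else 1 - p)
    (fun g b => ∀ f, ι f = g → b = ζ f)
  refine Eq.trans (Finset.sum_congr rfl fun ω _ => ?_) (this.trans ?_)
  · by_cases h : ω ∘ ι = ζ
    · rw [if_pos h, if_pos ((h1 ω).1 h)]
      rfl
    · rw [if_neg h, if_neg (mt (h1 ω).2 h)]
  unfold wt
  rw [← Finset.prod_subset (Finset.subset_univ (Finset.univ.image ι))]
  · rw [Finset.prod_image (fun a _ b _ h => hι h)]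
    refine Finset.prod_congr rfl fun f _ => ?_
    have h2 : ∀ b : Bool, (∀ f', ι f' = ι f → b = ζ f') ↔ b = ζ f := by
      intro b
      constructor
      · intro h
        exact h f rfl
      · intro h f' hf'
        rw [hι hf', h]
    simp only [h2]
    simp
  · intro g _ hg
    have h2 : ∀ b : Bool, (∀ f', ι f' = g → b = ζ f') := by
      intro b f' hf'
      exact absurd (Finset.mem_image.2 ⟨f', Finset.mem_univ _, hf'⟩) hg
    simp only [if_pos (h2 _)]
    simp

open Classical in
theorem marginal {F G : Type*} [Fintype F] [Fintype G] (p : ℝ) (ι : F → G)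
    (hι : Function.Injective ι) (B : Set (F → Bool)) :
    P p {ω : G → Bool | ω ∘ ι ∈ B} = P p B := by
  have : ∀ ζ : F → Bool, (if ζ ∈ B then wt p ζ else 0)
      = ∑ ω : G → Bool, if ω ∘ ι = ζ then (if ζ ∈ B then wt p ω else 0) else 0 := by
    intro ζ
    by_cases h : ζ ∈ B
    · simp only [h, if_true]
      exact (marginal_point p ι hι ζ).symm
    · simp [h]
  unfold P
  simp only [this]
  rw [Finset.sum_comm]
  refine Finset.sum_congr rfl fun ω _ => ?_
  simp

theorem P_univ {G : Type*} [Fintype G] (p : ℝ) : P p (Set.univ : Set (G → Bool)) = 1 := by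
  have := marginal p (fun x : Empty => (x.elim : G)) (fun x => x.elim) Set.univ
  simp only [Set.mem_univ, Set.ofPred_true] at this
  rw [this]
  simp [P, wt]

theorem P_compl {G : Type*} [Fintype G] (p : ℝ) (S : Set (G → Bool)) :
    P p Sᶜ = 1 - P p S := by
  rw [← P_univ (G := G) p, eq_sub_iff_add_eq]
  unfold P
  rw [← Finset.sum_add_distrib]
  refine Finset.sum_congr rfl fun ω _ => ?_
  by_cases h : ω ∈ S <;> simp [h]

theorem P_single {G : Type*} [Fintype G] (p : ℝ) (g : G) :
    P p {ω : G → Bool | ω g = true} = p := by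
  have := marginal p (fun _ : Unit => g) (fun _ _ _ => rfl) {ζ | ζ () = true}
  have h2 : {ω : G → Bool | (ω ∘ fun _ : Unit => g) ∈ {ζ : Unit → Bool | ζ () = true}}
    = {ω : G → Bool | ω g = true} := rfl
  rw [h2] at this
  rw [this]
  unfold P wt
  refine (@Fintype.sum_equiv _ _ _ (_) _ _ (Equiv.funUnique Unit Bool) _
    (fun b => if b = true then p else 0) ?_).trans ?_
  rotate_left
  · simp
  · intro ζ
    by_cases h : ζ () = true <;> simp [h]

open Classical in
/-- Sprinkling. -/
theorem sprinkle_point {G : Type*} [Fintype G] (p q : ℝ) (ω : G → Bool) :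
    (∑ a : G → Bool, ∑ b : G → Bool,
      if (∀ g, (a g || b g) = ω g) then wt p a * wt q b else 0) = wt (p + (1 - p) * q) ω := by
  have h := sum_constraint (G := G) (β := Bool × Bool)
    (fun _ b => (if b.1 = true then p else 1 - p) * (if b.2 = true then q else 1 - q))
    (fun g b => (b.1 || b.2) = ω g)
  rw [← Fintype.sum_prod_type', ← (Equiv.arrowProdEquivProdArrow G (fun _ => Bool) (fun _ => Bool)).sum_comp]
  unfold wt
  simp only [← Finset.prod_mul_distrib]
  refine Eq.trans (Finset.sum_congr rfl fun σ _ => ?_) (h.trans ?_)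
  · by_cases hσ : ∀ g, ((σ g).1 || (σ g).2) = ω g
    · rw [if_pos hσ]
      exact if_pos hσ
    · rw [if_neg hσ]
      exact if_neg hσ
  refine Finset.prod_congr rfl fun g _ => ?_
  rw [Fintype.sum_prod_type]
  cases ω g <;> simp <;> ring

open Classical in
theorem sprinkle {G : Type*} [Fintype G] (p q : ℝ) (S : Set (G → Bool)) :
    P (p + (1 - p) * q) S = ∑ a : G → Bool, wt p a * P q {b | (fun g => a g || b g) ∈ S} := by
  have h1 : ∀ ω : G → Bool, (if ω ∈ S then wt (p + (1 - p) * q) ω else 0)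
      = ∑ a : G → Bool, ∑ b : G → Bool,
        if (fun g => a g || b g) = ω then (if ω ∈ S then wt p a * wt q b else 0) else 0 := by
    intro ω
    by_cases h : ω ∈ S
    · simp only [h, if_true]
      rw [← sprinkle_point]
      simp only [funext_iff]
    · simp [h]
  unfold P
  simp only [h1]
  rw [Finset.sum_comm]
  refine Finset.sum_congr rfl fun a _ => ?_
  rw [Finset.sum_comm, Finset.mul_sum]
  refine Finset.sum_congr rfl fun b _ => ?_
  simp

open Classical in
/-- Sprinkling lower bound for an increasing event. -/
theorem sprinkle_lower {G : Type*} [Fintype G] {p q : ℝ} (hp0 : 0 ≤ p) (hp1 : p ≤ 1)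
    (hq0 : 0 ≤ q) (hq1 : q ≤ 1) (S : Set (G → Bool))
    (hS : ∀ a b : G → Bool, (∀ g, a g = true → b g = true) → a ∈ S → b ∈ S) :
    q * P p {a : G → Bool | ∃ g, Function.update a g true ∈ S} ≤ P (p + (1 - p) * q) S := by
  rw [sprinkle]
  unfold P
  rw [Finset.mul_sum]
  refine Finset.sum_le_sum fun a _ => ?_
  by_cases h : a ∈ {a : G → Bool | ∃ g, Function.update a g true ∈ S}
  · rw [if_pos h]
    obtain ⟨g, hg⟩ := h
    rw [mul_comm]
    refine mul_le_mul_of_nonneg_left ?_ (wt_nonneg hp0 hp1 a)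
    have h3 : P q {ω : G → Bool | ω g = true} ≤ P q {b : G → Bool | (fun g => a g || b g) ∈ S} := by
      refine P_mono hq0 hq1 fun b hb => ?_
      refine hS _ _ (fun g' hg' => ?_) hg
      by_cases hgg : g' = g
      · subst hgg
        have : b g' = true := hb
        simp [this]
      · rw [Function.update_of_ne hgg] at hg'
        simp [hg']
    rw [P_single] at h3
    exact h3
  · rw [if_neg h, mul_zero]
    exact mul_nonneg (wt_nonneg hp0 hp1 a) (P_nonneg hq0 hq1 _)

open Classical in
/-- Partition according to the values of a function. -/
theorem P_fiber {G α : Type*} [Fintype G] (p : ℝ) (f : (G → Bool) → α) (T : Finset α) :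
    ∑ c ∈ T, P p {ω | f ω = c} = P p {ω | f ω ∈ T} := by
  unfold P
  rw [Finset.sum_comm]
  refine Finset.sum_congr rfl fun ω _ => ?_
  simp

/-! ### Clusters -/

/-- Step along a set of open edges. -/
def stp {d : ℕ} (O : Set ((Fin d → ℤ) × Fin d)) (x y : Fin d → ℤ) : Prop :=
  (∃ i, y = x + TorusPerc.stdVec d i ∧ (x, i) ∈ O) ∨
  (∃ i, x = y + TorusPerc.stdVec d i ∧ (y, i) ∈ O)

/-- Cluster of the origin. -/
def cl {d : ℕ} (O : Set ((Fin d → ℤ) × Fin d)) : Set (Fin d → ℤ) :=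
  {y | Relation.ReflTransGen (stp O) 0 y}

/-- Edges touching a vertex set. -/
def touch {d : ℕ} (C : Set (Fin d → ℤ)) : Set ((Fin d → ℤ) × Fin d) :=
  {e | e.1 ∈ C ∨ e.1 + TorusPerc.stdVec d e.2 ∈ C}

theorem cl_local {d : ℕ} {O O' : Set ((Fin d → ℤ) × Fin d)} {C : Set (Fin d → ℤ)}
    (h : ∀ e ∈ touch C, e ∈ O ↔ e ∈ O') (hC : cl O = C) : cl O' = C := by
  subst hC
  apply Set.Subset.antisymm
  · intro y hy
    induction hy with
    | refl => exact Relation.ReflTransGen.refl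
    | @tail b c _ hbc ih =>
      refine Relation.ReflTransGen.tail ih ?_
      rcases hbc with ⟨i, rfl, hi⟩ | ⟨i, rfl, hi⟩
      · exact Or.inl ⟨i, rfl, (h _ (Or.inl ih)).2 hi⟩
      · exact Or.inr ⟨i, rfl, (h _ (Or.inr ih)).2 hi⟩
  · intro y hy
    have hy' : Relation.ReflTransGen (stp O) 0 y := hy
    clear hy
    induction hy' with
    | refl => exact Relation.ReflTransGen.refl
    | @tail b c h0 hbc ih =>
      refine Relation.ReflTransGen.tail ih ?_
      rcases hbc with ⟨i, rfl, hi⟩ | ⟨i, rfl, hi⟩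
      · exact Or.inl ⟨i, rfl, (h (b, i) (Or.inl h0)).1 hi⟩
      · exact Or.inr ⟨i, rfl, (h (c, i) (Or.inr h0)).1 hi⟩

/-- The probability that the cluster is `C`, computed through the touched edges. -/
theorem P_cl {d : ℕ} {G : Type*} [Fintype G] (p : ℝ) (C : Set (Fin d → ℤ))
    [Fintype (touch C)] (ι : touch C → G) (hι : Function.Injective ι)
    (O : (G → Bool) → Set ((Fin d → ℤ) × Fin d))
    (hO : ∀ ω, ∀ e : touch C, (e : (Fin d → ℤ) × Fin d) ∈ O ω ↔ ω (ι e) = true) :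
    P p {ω | cl (O ω) = C}
      = P p {ζ : touch C → Bool | cl {e | ∃ h : e ∈ touch C, ζ ⟨e, h⟩ = true} = C} := by
  rw [← marginal p ι hι]
  congr 1
  ext ω
  have key : ∀ e ∈ touch C, e ∈ O ω ↔
      e ∈ {e | ∃ h : e ∈ touch C, (ω ∘ ι) ⟨e, h⟩ = true} := by
    intro e he
    rw [hO ω ⟨e, he⟩]
    exact ⟨fun h => ⟨he, h⟩, fun ⟨_, h⟩ => h⟩
  exact ⟨cl_local key, cl_local fun e he => (key e he).symm⟩

/-! ### The torus -/

/-- Open edges of the periodic lift. -/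
def OT (d N : ℕ) (ω : TorusPerc.Config d N) : Set ((Fin d → ℤ) × Fin d) :=
  {e | ω (TorusPerc.proj d N e.1, e.2) = true}

/-- Open edges of the box. -/
def OB (d M : ℕ) (η : ZLattice.BoxConfig d M) : Set ((Fin d → ℤ) × Fin d) :=
  {e | ZLattice.edgeOpen d M η e.1 e.2}

/-- Projection of edges. -/
def eproj (d N : ℕ) (e : (Fin d → ℤ) × Fin d) : TorusPerc.Edge d N :=
  (TorusPerc.proj d N e.1, e.2)

theorem conn_mono {d N : ℕ} {a b : TorusPerc.Config d N} (h : ∀ g, a g = true → b g = true)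
    {x y : Fin d → ℤ} (hxy : TorusPerc.connected d N a x y) : TorusPerc.connected d N b x y := by
  unfold TorusPerc.connected at *
  refine Relation.ReflTransGen.mono ?_ _ _ hxy
  rintro u v (⟨i, rfl, hi⟩ | ⟨i, rfl, hi⟩)
  · exact Or.inl ⟨i, rfl, h _ hi⟩
  · exact Or.inr ⟨i, rfl, h _ hi⟩

theorem conn_symm {d N : ℕ} {a : TorusPerc.Config d N}
    {x y : Fin d → ℤ} (hxy : TorusPerc.connected d N a x y) : TorusPerc.connected d N a y x := by
  unfold TorusPerc.connected at *
  have : Std.Symm (TorusPerc.step d N a) := ⟨by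
    rintro u v (h | h)
    · exact Or.inr h
    · exact Or.inl h⟩
  exact Relation.ReflTransGen.stdSymm.symm _ _ hxy

open Classical in
/-- If two touched edges have the same projection, opening it creates a giant cycle. -/
theorem bad_pivotal {d N : ℕ} (ω : TorusPerc.Config d N)
    (h : ¬ Set.InjOn (eproj d N) (touch (cl (OT d N ω)))) :
    ∃ g, Function.update ω g true ∈ TorusPerc.giantEvent d N := by
  unfold Set.InjOn at h
  push Not at h
  obtain ⟨⟨x, i⟩, hx, ⟨x', i'⟩, hx', heq, hne⟩ := h
  simp only [eproj, Prod.mk.injEq] at heq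
  obtain ⟨hpr, rfl⟩ := heq
  refine ⟨(TorusPerc.proj d N x, i), x, x', fun h => hne (by rw [h]), hpr, ?_⟩
  have key : ∀ z, TorusPerc.proj d N z = TorusPerc.proj d N x →
      (z, i) ∈ touch (cl (OT d N ω)) →
      TorusPerc.connected d N (Function.update ω (TorusPerc.proj d N x, i) true) 0 z := by
    intro z hz ht
    have hm : ∀ y ∈ cl (OT d N ω),
        TorusPerc.connected d N (Function.update ω (TorusPerc.proj d N x, i) true) 0 y := by
      intro y hy
      refine conn_mono (a := ω) ?_ hy
      intro g hg
      by_cases hgg : g = (TorusPerc.proj d N x, i)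
      · subst hgg
        simp
      · rw [Function.update_of_ne hgg]
        exact hg
    rcases ht with ht | ht
    · exact hm _ ht
    · refine Relation.ReflTransGen.tail (hm _ ht) (Or.inr ⟨i, rfl, ?_⟩)
      simp [TorusPerc.liftOpen, hz]
  exact (conn_symm (key x rfl hx)).trans (key x' hpr.symm hx')

instance boxFinite (d M : ℕ) : Finite {e : (Fin d → ℤ) × Fin d // ZLattice.inBox d M e} := by
  have hf : Set.Finite ((Set.univ.pi fun _ : Fin d => Set.Icc (-(M : ℤ)) M) ×ˢ
      (Set.univ : Set (Fin d))) :=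
    (Set.Finite.pi' fun _ => Set.finite_Icc _ _).subset (by
      intro x hx j; exact hx j trivial) |>.prod Set.finite_univ
  refine (hf.subset ?_).to_subtype
  rintro ⟨x, i⟩ hx
  refine ⟨fun j _ => ?_, trivial⟩
  exact abs_le.1 (hx.1 j)

noncomputable instance boxFintype (d M : ℕ) :
    Fintype {e : (Fin d → ℤ) × Fin d // ZLattice.inBox d M e} := Fintype.ofFinite _

open Classical in
theorem finsum_eq_P {G : Type*} [Fintype G] (p : ℝ) (S : Set (G → Bool)) :
    (∑ᶠ ω ∈ S, ∏ᶠ g : G, (if ω g then p else 1 - p)) = P p S := by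
  unfold P wt
  rw [finsum_eq_sum_of_fintype]
  refine Finset.sum_congr rfl fun ω _ => ?_
  rw [finprod_eq_prod_of_fintype]
  by_cases h : ω ∈ S <;> simp [h]

theorem probT_eq (d N : ℕ) [NeZero N] (p : ℝ) (S : Set (TorusPerc.Config d N)) :
    TorusPerc.prob d N p S = P p S :=
  finsum_eq_P p S

theorem probB_eq (d M : ℕ) (p : ℝ) (S : Set (ZLattice.BoxConfig d M)) :
    ZLattice.prob d M p S = P p S :=
  finsum_eq_P p S

theorem cl_finite {d N : ℕ} [NeZero N] (hd : 0 < d) {C : Set (Fin d → ℤ)}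
    (h : Set.InjOn (eproj d N) (touch C)) : C.Finite := by
  have h2 : Set.InjOn (TorusPerc.proj d N) C := by
    intro x hx y hy hxy
    have hx' : (x, (⟨0, hd⟩ : Fin d)) ∈ touch C := Or.inl hx
    have hy' : (y, (⟨0, hd⟩ : Fin d)) ∈ touch C := Or.inl hy
    have := h hx' hy' (by simp [eproj, hxy])
    exact congrArg Prod.fst this
  exact Set.Finite.of_finite_image (Set.toFinite _) h2

theorem touch_finite {d N : ℕ} [NeZero N] {C : Set (Fin d → ℤ)}
    (h : Set.InjOn (eproj d N) (touch C)) : (touch C).Finite :=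
  Set.Finite.of_finite_image (Set.toFinite _) h

/-- The probability of a good torus cluster is at most the probability of a finite cluster. -/
theorem good_le {d N : ℕ} [NeZero N] (hd : 0 < d) {p : ℝ} (hp0 : 0 ≤ p) (hp1 : p ≤ 1) :
    P p {ω : TorusPerc.Config d N | Set.InjOn (eproj d N) (touch (cl (OT d N ω)))}
      ≤ 1 - ZLattice.theta d p := by
  classical
  let good : Finset (TorusPerc.Config d N) :=
    Finset.univ.filter fun ω => Set.InjOn (eproj d N) (touch (cl (OT d N ω)))
  let T : Finset (Set (Fin d → ℤ)) := good.image fun ω => cl (OT d N ω)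
  have hT : ∀ C ∈ T, Set.InjOn (eproj d N) (touch C) := by
    intro C hC
    obtain ⟨ω, hω, rfl⟩ := Finset.mem_image.1 hC
    exact (Finset.mem_filter.1 hω).2
  -- choose a large box
  have hU : (⋃ C ∈ T, C).Finite := T.finite_toSet.biUnion fun C hC => cl_finite hd (hT C hC)
  obtain ⟨M, hM⟩ : ∃ M : ℕ, ∀ C ∈ T, ∀ x ∈ C, ∀ j, |x j| + 1 < (M : ℤ) := by
    have hV : ((fun xj : (Fin d → ℤ) × Fin d => (|xj.1 xj.2|)) ''
      ((⋃ C ∈ T, C) ×ˢ Set.univ)).Finite := (hU.prod Set.finite_univ).image _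
    obtain ⟨B, hB⟩ := hV.bddAbove
    refine ⟨(B + 2).toNat, fun C hC x hx j => ?_⟩
    have : |x j| ≤ B := hB ⟨(x, j), ⟨Set.mem_biUnion hC hx, trivial⟩, rfl⟩
    have h2 := Int.self_le_toNat (B + 2)
    omega
  have hbox : ∀ C ∈ T, ∀ e ∈ touch C, ZLattice.inBox d M e := by
    have hs : ∀ (i j : Fin d), 0 ≤ TorusPerc.stdVec d i j ∧ TorusPerc.stdVec d i j ≤ 1 := by
      intro i j
      unfold TorusPerc.stdVec
      split_ifs <;> simp
    rintro C hC ⟨x, i⟩ (hx | hx)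
    · refine ⟨fun j => ?_, fun j => ?_⟩
      · have := hM C hC x hx j
        simp only
        omega
      · have := hM C hC x hx j
        have h3 := hs i j
        simp only [Pi.add_apply] at *
        rw [abs_le]
        have h4 := abs_lt.1 (show |x j| < (M : ℤ) - 1 by omega)
        omega
    · refine ⟨fun j => ?_, fun j => ?_⟩
      · have := hM C hC _ hx j
        have h3 := hs i j
        simp only [Pi.add_apply] at *
        rw [abs_le]
        have h4 := abs_lt.1 (show |x j + TorusPerc.stdVec d i j| < (M : ℤ) - 1 by omega)
        omega
      · have := hM C hC _ hx j
        simp only [Pi.add_apply] at *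
        omega
  have hle : ZLattice.theta d p ≤ P p (ZLattice.reachBoundary d M) := by
    rw [← probB_eq]
    refine ciInf_le ⟨0, ?_⟩ M
    rintro _ ⟨M', rfl⟩
    simp only [probB_eq]
    exact P_nonneg hp0 hp1 _
  have hset : {ω : TorusPerc.Config d N | Set.InjOn (eproj d N) (touch (cl (OT d N ω)))}
      = {ω | cl (OT d N ω) ∈ T} := by
    ext ω
    constructor
    · intro h
      exact Finset.mem_image.2 ⟨ω, Finset.mem_filter.2 ⟨Finset.mem_univ _, h⟩, rfl⟩
    · intro h
      exact hT _ h
  have hB : P p {η : ZLattice.BoxConfig d M | cl (OB d M η) ∈ T}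
      ≤ P p (ZLattice.reachBoundary d M)ᶜ := by
    refine P_mono hp0 hp1 ?_
    rintro η hη ⟨y, ⟨j, hj⟩, hy⟩
    have := hM _ hη y hy j
    omega
  rw [P_compl] at hB
  rw [hset, ← P_fiber]
  rw [← P_fiber] at hB
  refine le_trans (le_of_eq ?_) (hB.trans (by linarith))
  refine Finset.sum_congr rfl fun C hC => ?_
  have : Fintype (touch C) := (touch_finite (hT C hC)).fintype
  rw [P_cl p C (fun e => eproj d N e) (fun a b h => Subtype.ext (hT C hC a.2 b.2 h)) (OT d N)
    (fun ω e => Iff.rfl)]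
  rw [P_cl p C (fun e => (⟨e, hbox C hC e e.2⟩ : {e // ZLattice.inBox d M e}))
    (fun a b h => Subtype.ext (Subtype.mk.inj h)) (OB d M)
    (fun η e => ⟨fun ⟨_, h⟩ => h, fun h => ⟨_, h⟩⟩)]

end GiantProof

/-- Fix `d ≥ 2` and `p > p̂_c(d)`.  Then there exists `δ > 0` such that for every `N ≥ 1`,
bond percolation on the torus `T^d_N` satisfies `ℙ_p(A^□) ≥ δ`. -/
theorem torus_giant_prob_supercritical_lower_bound (d : ℕ) (hd : 2 ≤ d) (p : ℝ)
    (hp1 : p ≤ 1) (hp : ZLattice.hatPc d < p) :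
    ∃ δ : ℝ, 0 < δ ∧ ∀ N : ℕ, 1 ≤ N →
      δ ≤ TorusPerc.prob d N p (TorusPerc.giantEvent d N) := by
  obtain ⟨p₁, hc, hpp⟩ := exists_between hp
  have hpc0 : 0 ≤ ZLattice.hatPc d := Real.sSup_nonneg fun x hx => hx.1.1
  have hp10 : 0 < p₁ := lt_of_le_of_lt hpc0 hc
  have hp11 : p₁ < 1 := lt_of_lt_of_le hpp hp1
  have hth0 : 0 ≤ ZLattice.theta d p₁ := by
    refine Real.iInf_nonneg fun M => ?_
    rw [GiantProof.probB_eq]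
    exact GiantProof.P_nonneg hp10.le hp11.le _
  have hthne : ZLattice.theta d p₁ ≠ 0 := by
    intro h
    have : p₁ ≤ ZLattice.hatPc d :=
      le_csSup ⟨1, fun x hx => hx.1.2⟩ ⟨⟨hp10.le, hp11.le⟩, h⟩
    linarith
  have hth : 0 < ZLattice.theta d p₁ := lt_of_le_of_ne hth0 (Ne.symm hthne)
  have h1p : 0 < 1 - p₁ := by linarith
  have hq0 : 0 < (p - p₁) / (1 - p₁) := div_pos (by linarith) h1p
  have hq1 : (p - p₁) / (1 - p₁) ≤ 1 := by
    rw [div_le_one h1p]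
    linarith
  refine ⟨(p - p₁) / (1 - p₁) * ZLattice.theta d p₁, mul_pos hq0 hth, fun N hN => ?_⟩
  have : NeZero N := ⟨by omega⟩
  have hpq : p = p₁ + (1 - p₁) * ((p - p₁) / (1 - p₁)) := by
    field_simp
    ring
  have hlow := GiantProof.sprinkle_lower hp10.le hp11.le hq0.le hq1 (TorusPerc.giantEvent d N)
    (by
      rintro a b hab ⟨x, y, hne, hxy, hconn⟩
      exact ⟨x, y, hne, hxy, GiantProof.conn_mono hab hconn⟩)
  rw [← hpq] at hlow
  rw [GiantProof.probT_eq]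
  refine le_trans (mul_le_mul_of_nonneg_left ?_ hq0.le) hlow
  have hgood := GiantProof.good_le (d := d) (N := N) (by omega) hp10.le hp11.le
  have hbad := GiantProof.P_mono hp10.le hp11.le
    (show {ω : TorusPerc.Config d N | Set.InjOn (GiantProof.eproj d N)
        (GiantProof.touch (GiantProof.cl (GiantProof.OT d N ω)))}ᶜ ⊆
        {a | ∃ g, Function.update a g true ∈ TorusPerc.giantEvent d N} from
      fun ω hω => GiantProof.bad_pivotal ω hω)
  rw [GiantProof.P_compl] at hbad
  refine le_trans ?_ (hbad.trans (le_of_eq (by congr!)))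
  linarith
end
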